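/- Let K, N, M be positive natural numbers, P a real number, G and ω real matrices indexed by {1,…,K} × {1,…,N} with G_{i,g}·ω_{i,g} ≥ 0 for all i, g, and μ : {1,…,K} → ℝ with μ_i ≥ 0 for all i. Suppose that for every g the quantity λ_g = Σ_{i=1}^{K} μ_i·G_{i,g}·ω_{i,g} is strictly positive, and define η*_g = max(0, M/(2·K·N·λ_g) − 1/M). Assume (feasibility) Σ_g G_{i,g}·ω_{i,g}·η*_g ≤ P for every i, and (complementary slackness) μ_i·(Σ_g G_{i,g}·ω_{i,g}·η*_g − P) = 0 for every i. Then for every η : {1,…,N} → ℝ with η_g ≥ 0 for all g and Σ_g G_{i,g}·ω_{i,g}·η_g ≤ P for every i, it holds that Σ_g log(N/M + N·η_g) ≤ Σ_g log(N/M + N·η*_g). -/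

import Mathlib

/-- Tangent-line bound for the logarithm at a water-filling level `max 0 (1 / c - a)`:
the marginal gain is at most the price `c`, with equality when the level is positive. -/
theorem log_sub_log_waterfilling_le {n a c x y : ℝ} (hn : 0 < n) (ha : 0 < a) (hc : 0 < c)
    (hx : 0 ≤ x) (hy : y = max 0 (1 / c - a)) :
    Real.log (n * a + n * x) - Real.log (n * a + n * y) ≤ c * (x - y) := by
  have hy0 : 0 ≤ y := hy ▸ le_max_left _ _
  have hpx : 0 < n * a + n * x := by positivity
  have hpy : 0 < n * a + n * y := by positivity
  have hay : 0 < a + y := by positivity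
  rw [← Real.log_div hpx.ne' hpy.ne']
  have hratio : (n * a + n * x) / (n * a + n * y) - 1 = (x - y) / (a + y) := by
    rw [← mul_add, ← mul_add, mul_div_mul_left _ _ hn.ne']
    field_simp
    ring
  refine (Real.log_le_sub_one_of_pos (div_pos hpx hpy)).trans ?_
  rw [hratio, div_le_iff₀ hay]
  rcases le_total (1 / c - a) 0 with h | h
  · rw [max_eq_left h] at hy
    have hca : 1 ≤ c * a := by
      rw [sub_nonpos, div_le_iff₀ hc] at h
      linarith
    subst hy
    nlinarith [mul_le_mul_of_nonneg_left hca hx]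
  · rw [max_eq_right h] at hy
    have hcay : c * (a + y) = 1 := by
      rw [hy]
      field_simp
      ring
    exact le_of_eq (by linear_combination (-(x - y)) * hcay)

/-- Complementary slackness: no feasible point costs more, at the prices given by the
multipliers, than a point satisfying complementary slackness. -/
theorem sum_price_mul_sub_nonpos {ι κ : Type*} [Fintype ι] [Fintype κ] {A : ι → κ → ℝ}
    {μ : ι → ℝ} {P : ℝ} {x y : κ → ℝ} (hμ : ∀ i, 0 ≤ μ i)
    (hx : ∀ i, ∑ g, A i g * x g ≤ P) (hy : ∀ i, μ i * ((∑ g, A i g * y g) - P) = 0) :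
    ∑ g, (∑ i, μ i * A i g) * (x g - y g) ≤ 0 := by
  have hswap : ∑ g, (∑ i, μ i * A i g) * (x g - y g) =
      ∑ i, μ i * ((∑ g, A i g * x g) - ∑ g, A i g * y g) := by
    simp only [Finset.sum_mul, ← Finset.sum_sub_distrib, Finset.mul_sum]
    rw [Finset.sum_comm]
    exact Finset.sum_congr rfl fun i _ => Finset.sum_congr rfl fun g _ => by ring
  rw [hswap]
  refine Finset.sum_nonpos fun i _ => ?_
  nlinarith [hy i, mul_le_mul_of_nonneg_left (hx i) (hμ i)]

/-- KKT sufficiency for the power-allocation problem: if the levels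
`η*_g = max(0, M/(2·K·N·λ_g) − 1/M)` with `λ_g = Σ_i μ_i·G_{i,g}·ω_{i,g} > 0` are feasible
and satisfy complementary slackness with nonnegative multipliers `μ_i`, then they maximize
`Σ_g log(N/M + N·η_g)` over all feasible `η`. -/
theorem stmt_10 (K N M : ℕ) (hK : 0 < K) (hN : 0 < N) (hM : 0 < M) (P : ℝ)
    (G ω : Fin K → Fin N → ℝ) (hGω : ∀ i g, 0 ≤ G i g * ω i g)
    (μ : Fin K → ℝ) (hμ : ∀ i, 0 ≤ μ i)
    (hlam : ∀ g, 0 < ∑ i, μ i * G i g * ω i g)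
    (η' : Fin N → ℝ)
    (hη' : ∀ g, η' g =
      max 0 ((M : ℝ) / (2 * K * N * ∑ i, μ i * G i g * ω i g) - 1 / M))
    (hfeas : ∀ i, ∑ g, G i g * ω i g * η' g ≤ P)
    (hcs : ∀ i, μ i * ((∑ g, G i g * ω i g * η' g) - P) = 0) :
    ∀ η : Fin N → ℝ, (∀ g, 0 ≤ η g) →
      (∀ i, ∑ g, G i g * ω i g * η g ≤ P) →
      ∑ g, Real.log ((N : ℝ) / M + N * η g) ≤
        ∑ g, Real.log ((N : ℝ) / M + N * η' g) := by
  intro η hη hηP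
  have hK' : (0 : ℝ) < K := Nat.cast_pos.2 hK
  have hN' : (0 : ℝ) < N := Nat.cast_pos.2 hN
  have hM' : (0 : ℝ) < M := Nat.cast_pos.2 hM
  have hc : (0 : ℝ) < 2 * K * N / M := by positivity
  have hbound : ∀ g, Real.log ((N : ℝ) / M + N * η g) - Real.log ((N : ℝ) / M + N * η' g) ≤
      2 * K * N / M * ((∑ i, μ i * (G i g * ω i g)) * (η g - η' g)) := by
    intro g
    have hlevel : η' g =
        max 0 (1 / (2 * K * N / M * ∑ i, μ i * G i g * ω i g) - 1 / (M : ℝ)) := by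
      rw [hη' g, div_mul_eq_mul_div, one_div_div]
    have h := log_sub_log_waterfilling_le hN' (one_div_pos.2 hM') (mul_pos hc (hlam g))
      (hη g) hlevel
    simpa only [mul_one_div, mul_assoc] using h
  have hprice := sum_price_mul_sub_nonpos (A := fun i g => G i g * ω i g) hμ hηP hcs
  rw [← sub_nonpos, ← Finset.sum_sub_distrib]
  refine (Finset.sum_le_sum fun g _ => hbound g).trans ?_
  rw [← Finset.mul_sum]
  exact mul_nonpos_of_nonneg_of_nonpos hc.le hprice
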